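/- arXiv:2005.08934 — 9 statements merged into one kernel-verified Lean document; each statement's English description precedes it below -/
import Mathlib

section
/- Let n ≥ 1, let P be an n×n real row-stochastic matrix (all entries nonnegative and each row sums to 1), and let π be a probability vector on Fin n satisfying the detailed balance condition π i · P i j = π j · P j i for all i, j. Then for every integer t ≥ 1 and every x : Fin n → ℝ, one has ∑_{i,j} π i · (P^t) i j · (x i − x j)^2 ≤ t · ∑_{i,j} π i · P i j · (x i − x j)^2. (Equivalently: the stationary reversible Markov chain {Z_s} with transition matrix P and initial law π satisfies E[(x_{Z_t} − x_{Z_0})^2] ≤ t · E[(x_{Z_1} − x_{Z_0})^2], i.e., the real line has Markov type 2 with constant 1.) -/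
open Matrix in
theorem reversible_pow {n : Type*} [Fintype n] [DecidableEq n] {P : Matrix n n ℝ} {π : n → ℝ}
    (hrev : ∀ i j, π i * P i j = π j * P j i) (t : ℕ) (i j : n) :
    π i * (P ^ t) i j = π j * (P ^ t) j i := by
  have h : SemiconjBy (diagonal π) P Pᵀ := by
    ext i j
    simp [diagonal_mul, mul_diagonal, hrev i j, mul_comm]
  have h' := congrFun (congrFun (h.pow_right t).eq i) j
  rw [← transpose_pow, diagonal_mul, mul_diagonal, transpose_apply] at h'
  rw [h', mul_comm]

theorem pow_row_sum {n : Type*} [Fintype n] [DecidableEq n] {P : Matrix n n ℝ}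
    (hrow : ∀ i, ∑ j, P i j = 1) (t : ℕ) (i : n) : ∑ j, (P ^ t) i j = 1 := by
  induction t generalizing i with
  | zero => simp [Matrix.one_apply]
  | succ t ih =>
    simp only [pow_succ, Matrix.mul_apply]
    rw [Finset.sum_comm]
    simp [← Finset.mul_sum, hrow, ih]

open Matrix in
/-- A reversible matrix is self-adjoint for the inner product weighted by `π`. -/
theorem weighted_dotProduct_mulVec {n : Type*} [Fintype n] {Q : Matrix n n ℝ} {π : n → ℝ}
    (hrev : ∀ i j, π i * Q i j = π j * Q j i) (f g : n → ℝ) :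
    f ⬝ᵥ (π * Q *ᵥ g) = (Q *ᵥ f) ⬝ᵥ (π * g) := by
  simp only [dotProduct, mulVec, Pi.mul_apply, Finset.mul_sum, Finset.sum_mul]
  rw [Finset.sum_comm]
  refine Finset.sum_congr rfl fun j _ => Finset.sum_congr rfl fun i _ => ?_
  linear_combination f i * g j * hrev i j

open Matrix in
theorem sum_reversible_sq {n : Type*} [Fintype n] {Q : Matrix n n ℝ} {π : n → ℝ}
    (hrow : ∀ i, ∑ j, Q i j = 1) (hrev : ∀ i j, π i * Q i j = π j * Q j i)
    (c : ℝ) (f : n → ℝ) :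
    ∑ i, ∑ j, π i * Q i j * (f i + c * f j) ^ 2 =
      (1 + c ^ 2) * f ⬝ᵥ (π * f) + 2 * c * f ⬝ᵥ (π * Q *ᵥ f) := by
  have h₁ : ∑ i, ∑ j, π i * Q i j * f i ^ 2 = f ⬝ᵥ (π * f) := by
    refine Finset.sum_congr rfl fun i _ => ?_
    rw [← Finset.sum_mul, ← Finset.mul_sum, hrow, Pi.mul_apply]
    ring
  have h₂ : ∑ i, ∑ j, π i * Q i j * f j ^ 2 = f ⬝ᵥ (π * f) := by
    rw [Finset.sum_comm, ← h₁]
    simp only [hrev]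
  have h₃ : ∑ i, ∑ j, π i * Q i j * (f i * f j) = f ⬝ᵥ (π * Q *ᵥ f) := by
    simp only [dotProduct, mulVec, Pi.mul_apply, Finset.mul_sum]
    exact Finset.sum_congr rfl fun i _ => Finset.sum_congr rfl fun j _ => by ring
  calc
    _ = ∑ i, ∑ j, (π i * Q i j * f i ^ 2 + c ^ 2 * (π i * Q i j * f j ^ 2)
          + 2 * c * (π i * Q i j * (f i * f j))) :=
      Finset.sum_congr rfl fun i _ => Finset.sum_congr rfl fun j _ => by ring
    _ = _ := by
      simp only [Finset.sum_add_distrib, ← Finset.mul_sum, h₁, h₂, h₃]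
      ring

section Dirichlet

open Matrix

variable {n : Type*} [Fintype n] {P : Matrix n n ℝ} {π : n → ℝ}

theorem weighted_dotProduct_self_add_nonneg (hP : ∀ i j, 0 ≤ P i j) (hrow : ∀ i, ∑ j, P i j = 1)
    (hπ : ∀ i, 0 ≤ π i) (hrev : ∀ i j, π i * P i j = π j * P j i)
    {c : ℝ} (hc : c ^ 2 = 1) (f : n → ℝ) :
    0 ≤ f ⬝ᵥ (π * f) + c * f ⬝ᵥ (π * P *ᵥ f) := by
  have h := sum_reversible_sq hrow hrev c f
  have h₀ : 0 ≤ ∑ i, ∑ j, π i * P i j * (f i + c * f j) ^ 2 :=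
    Finset.sum_nonneg fun i _ => Finset.sum_nonneg fun j _ =>
      mul_nonneg (mul_nonneg (hπ i) (hP i j)) (sq_nonneg _)
  rw [hc] at h
  linarith

/-- The Dirichlet form of a reversible chain does not increase under the chain. -/
theorem dirichlet_mulVec_le (hP : ∀ i j, 0 ≤ P i j) (hrow : ∀ i, ∑ j, P i j = 1)
    (hπ : ∀ i, 0 ≤ π i) (hrev : ∀ i j, π i * P i j = π j * P j i) (f : n → ℝ) :
    (P *ᵥ f) ⬝ᵥ (π * P *ᵥ f) - (P *ᵥ f) ⬝ᵥ (π * P *ᵥ (P *ᵥ f)) ≤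
      f ⬝ᵥ (π * f) - f ⬝ᵥ (π * P *ᵥ f) := by
  have h := weighted_dotProduct_self_add_nonneg hP hrow hπ hrev (c := 1) (by norm_num)
    (f - P *ᵥ f)
  have h₁ := weighted_dotProduct_mulVec hrev f f
  have h₂ := weighted_dotProduct_mulVec hrev f (P *ᵥ f)
  simp only [mulVec_sub, mul_sub, sub_dotProduct, dotProduct_sub] at h
  linarith

variable [DecidableEq n]

theorem dirichlet_pow_mulVec_le (hP : ∀ i j, 0 ≤ P i j) (hrow : ∀ i, ∑ j, P i j = 1)
    (hπ : ∀ i, 0 ≤ π i) (hrev : ∀ i j, π i * P i j = π j * P j i) (f : n → ℝ) (t : ℕ) :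
    (P ^ t *ᵥ f) ⬝ᵥ (π * P ^ t *ᵥ f) - (P ^ t *ᵥ f) ⬝ᵥ (π * P *ᵥ (P ^ t *ᵥ f)) ≤
      f ⬝ᵥ (π * f) - f ⬝ᵥ (π * P *ᵥ f) := by
  induction t with
  | zero => simp
  | succ t ih =>
    have h := dirichlet_mulVec_le hP hrow hπ hrev (P ^ t *ᵥ f)
    rw [pow_succ', ← mulVec_mulVec]
    exact h.trans ih

/-- The decrements of the autocorrelations `⟨f, P ^ t f⟩` are largest at `t = 0`. -/
theorem autocorrelation_sub_le (hP : ∀ i j, 0 ≤ P i j) (hrow : ∀ i, ∑ j, P i j = 1)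
    (hπ : ∀ i, 0 ≤ π i) (hrev : ∀ i j, π i * P i j = π j * P j i) (f : n → ℝ) (t : ℕ) :
    f ⬝ᵥ (π * P ^ t *ᵥ f) - f ⬝ᵥ (π * P ^ (t + 1) *ᵥ f) ≤
      f ⬝ᵥ (π * f) - f ⬝ᵥ (π * P *ᵥ f) := by
  have h := weighted_dotProduct_self_add_nonneg hP hrow hπ hrev (c := -1) (by norm_num)
    (f - P ^ t *ᵥ f)
  have h₁ := dirichlet_pow_mulVec_le hP hrow hπ hrev f t
  have h₂ := weighted_dotProduct_mulVec (reversible_pow hrev t) f f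
  have h₃ := weighted_dotProduct_mulVec (reversible_pow hrev t) f (P *ᵥ f)
  rw [mulVec_mulVec, ← pow_succ] at h₃
  simp only [mulVec_sub, mul_sub, sub_dotProduct, dotProduct_sub] at h
  rw [mulVec_mulVec, ← pow_succ'] at h h₁
  linarith

theorem autocorrelation_zero_sub_le (hP : ∀ i j, 0 ≤ P i j) (hrow : ∀ i, ∑ j, P i j = 1)
    (hπ : ∀ i, 0 ≤ π i) (hrev : ∀ i j, π i * P i j = π j * P j i) (f : n → ℝ) (t : ℕ) :
    f ⬝ᵥ (π * f) - f ⬝ᵥ (π * P ^ t *ᵥ f) ≤ t * (f ⬝ᵥ (π * f) - f ⬝ᵥ (π * P *ᵥ f)) := by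
  induction t with
  | zero => simp
  | succ t ih =>
    have h := autocorrelation_sub_le hP hrow hπ hrev f t
    push_cast
    linarith

end Dirichlet


/-- Markov type 2 of the real line with constant 1, for a stationary reversible
finite Markov chain: `E[(x(Z_t) - x(Z_0))^2] ≤ t * E[(x(Z_1) - x(Z_0))^2]`. -/
theorem stmt0 (n : ℕ) (hn : 1 ≤ n) (P : Matrix (Fin n) (Fin n) ℝ)
    (hP : ∀ i j, 0 ≤ P i j) (hrow : ∀ i, ∑ j, P i j = 1)
    (π : Fin n → ℝ) (hπ : ∀ i, 0 ≤ π i) (hπ1 : ∑ i, π i = 1)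
    (hrev : ∀ i j, π i * P i j = π j * P j i)
    (t : ℕ) (ht : 1 ≤ t) (x : Fin n → ℝ) :
    ∑ i, ∑ j, π i * (P ^ t) i j * (x i - x j) ^ 2 ≤
      (t : ℝ) * ∑ i, ∑ j, π i * P i j * (x i - x j) ^ 2 := by
  have h := autocorrelation_zero_sub_le hP hrow hπ hrev x t
  have h₁ := sum_reversible_sq hrow hrev (-1) x
  have h₂ := sum_reversible_sq (pow_row_sum hrow t) (reversible_pow hrev t) (-1) x
  simp only [neg_one_mul, ← sub_eq_add_neg] at h₁ h₂
  rw [h₁, h₂]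
  linarith
end

section
/- Let n ≥ 1, let P be an n×n real row-stochastic matrix, and let π be a probability vector on Fin n satisfying the detailed balance condition π i · P i j = π j · P j i for all i, j. Then for every integer t ≥ 1 and every x : Fin n → ℝ, ∑_{i,j,k} π i · (P^{t−1}) i j · P j k · (x k − x j) · (x j − x i) = −⟨x, (I − P)(I − P^{t−1}) x⟩_π, where I is the n×n identity matrix, the matrix (I − P)(I − P^{t−1}) acts on x by matrix-vector multiplication, and ⟨u, v⟩_π := ∑_i π i · u i · v i. (The left-hand side equals E[(x_{Z_t} − x_{Z_{t−1}})(x_{Z_{t−1}} − x_{Z_0})] for the stationary reversible chain with transition matrix P and initial law π.) -/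
namespace Matrix

variable {ι R : Type*} [Fintype ι] [CommRing R]

/-- Detailed balance with respect to `w` is inherited by powers of a matrix. -/
theorem detailedBalance_pow [DecidableEq ι] {w : ι → R} {A : Matrix ι ι R}
    (h : ∀ i j, w i * A i j = w j * A j i) (m : ℕ) (i j : ι) :
    w i * (A ^ m) i j = w j * (A ^ m) j i := by
  have hA : SemiconjBy (diagonal w) A Aᵀ := by
    ext i j
    simp [diagonal_mul, mul_diagonal, h i j, mul_comm]
  have hAm := congrFun₂ (hA.pow_right m).eq i j
  rw [← transpose_pow, diagonal_mul, mul_diagonal, transpose_apply] at hAm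
  rw [hAm, mul_comm]

/-- A matrix in detailed balance with `w` is self-adjoint for the `w`-weighted bilinear form. -/
theorem sum_mul_mulVec_of_detailedBalance {w : ι → R} {A : Matrix ι ι R}
    (h : ∀ i j, w i * A i j = w j * A j i) (u v : ι → R) :
    ∑ i, w i * u i * (A *ᵥ v) i = ∑ i, w i * (A *ᵥ u) i * v i := by
  simp only [mulVec, dotProduct, Finset.mul_sum, Finset.sum_mul]
  rw [Finset.sum_comm]
  refine Finset.sum_congr rfl fun i _ => Finset.sum_congr rfl fun j _ => ?_
  linear_combination u j * v i * h j i

theorem pow_mulVec_of_mulVec_eq [DecidableEq ι] {A : Matrix ι ι R} {v : ι → R}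
    (h : A *ᵥ v = v) (m : ℕ) : (A ^ m) *ᵥ v = v := by
  induction m with
  | zero => simp
  | succ m ih => rw [pow_succ, ← mulVec_mulVec, h, ih]

end Matrix

open Matrix in

/-- For a stationary reversible finite Markov chain with transition matrix `P`
and initial law `π`, the correlation of increments
`E[(x(Z_t) - x(Z_{t-1})) (x(Z_{t-1}) - x(Z_0))]` equals
`-⟨x, (I - P)(I - P^{t-1}) x⟩_π`. -/
theorem stmt1 (n : ℕ) (hn : 1 ≤ n) (P : Matrix (Fin n) (Fin n) ℝ)
    (hP : ∀ i j, 0 ≤ P i j) (hrow : ∀ i, ∑ j, P i j = 1)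
    (π : Fin n → ℝ) (hπ : ∀ i, 0 ≤ π i) (hπ1 : ∑ i, π i = 1)
    (hrev : ∀ i j, π i * P i j = π j * P j i)
    (t : ℕ) (ht : 1 ≤ t) (x : Fin n → ℝ) :
    ∑ i, ∑ j, ∑ k, π i * (P ^ (t - 1)) i j * P j k * (x k - x j) * (x j - x i) =
      - ∑ i, π i * x i * ((1 - P) * (1 - P ^ (t - 1))).mulVec x i := by
  have hP1 : P *ᵥ 1 = 1 := by
    ext i
    simp [mulVec, dotProduct, hrow]
  set Q := P ^ (t - 1) with hQ
  have hQ1 : Q *ᵥ 1 = 1 := pow_mulVec_of_mulVec_eq hP1 _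
  have hQrev : ∀ i j, π i * Q i j = π j * Q j i := detailedBalance_pow hrev _
  set y := P *ᵥ x - x with hy
  have hstep : ∀ j, ∑ k, P j k * (x k - x j) = y j := fun j => by
    simp only [mul_sub, Finset.sum_sub_distrib, ← Finset.sum_mul, hrow, one_mul]
    rfl
  have hleft : ∑ i, ∑ j, ∑ k, π i * Q i j * P j k * (x k - x j) * (x j - x i) =
      ∑ i, π i * (1 : Fin n → ℝ) i * (Q *ᵥ (y * x)) i - ∑ i, π i * x i * (Q *ᵥ y) i := by
    simp only [mulVec, dotProduct, Finset.mul_sum, ← Finset.sum_sub_distrib]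
    refine Finset.sum_congr rfl fun i _ => Finset.sum_congr rfl fun j _ => ?_
    calc ∑ k, π i * Q i j * P j k * (x k - x j) * (x j - x i)
        = π i * Q i j * (x j - x i) * ∑ k, P j k * (x k - x j) := by
          rw [Finset.mul_sum]
          exact Finset.sum_congr rfl fun k _ => by ring
      _ = _ := by
          rw [hstep, Pi.mul_apply, Pi.one_apply]
          ring
  have hright : ∑ i, π i * x i * (((1 - P) * (1 - Q)) *ᵥ x) i =
      ∑ i, π i * x i * (x - Q *ᵥ x) i - ∑ i, π i * x i * (P *ᵥ (x - Q *ᵥ x)) i := by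
    simp only [← mulVec_mulVec, sub_mulVec, one_mulVec, ← Finset.sum_sub_distrib, ← mul_sub,
      Pi.sub_apply]
  rw [hleft, hright, sum_mul_mulVec_of_detailedBalance hQrev,
    sum_mul_mulVec_of_detailedBalance hQrev, sum_mul_mulVec_of_detailedBalance hrev, hQ1,
    ← Finset.sum_sub_distrib, ← Finset.sum_sub_distrib, ← Finset.sum_neg_distrib]
  refine Finset.sum_congr rfl fun i _ => ?_
  simp only [hy, Pi.mul_apply, Pi.one_apply, Pi.sub_apply]
  ring
end

section
/- Let n ≥ 1, let P be an n×n real row-stochastic matrix, and let π be a probability vector on Fin n satisfying the detailed balance condition π i · P i j = π j · P j i for all i, j. Then for every integer t ≥ 1 the matrix (I − P)(I − P^{t−1}) is positive semidefinite with respect to the π-inner product: for every x : Fin n → ℝ, ⟨x, (I − P)(I − P^{t−1}) x⟩_π ≥ 0, where ⟨u, v⟩_π := ∑_i π i · u i · v i. (Consequently, for the stationary reversible chain {Z_s} and any observable x, the increments satisfy the negative correlation inequality E[(x_{Z_t} − x_{Z_{t−1}})(x_{Z_{t−1}} − x_{Z_0})] ≤ 0.) -/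
open Matrix in
/-- The quadratic form of `diagonal π * A` is the `π`-weighted quadratic form of `A`. -/
theorem dotProduct_diagonal_mul_mulVec {ι : Type*} [Fintype ι] [DecidableEq ι]
    (π : ι → ℝ) (A : Matrix ι ι ℝ) (x : ι → ℝ) :
    x ⬝ᵥ ((diagonal π * A) *ᵥ x) = ∑ i, π i * x i * (A *ᵥ x) i := by
  rw [← mulVec_mulVec, dotProduct]
  refine Finset.sum_congr rfl fun i _ => ?_
  rw [mulVec_diagonal]
  ring

open Matrix in
/-- Detailed balance says that `P` is self-adjoint for the `π`-inner product. -/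
theorem diagonal_mul_eq_transpose_mul_diagonal {ι : Type*} [Fintype ι] [DecidableEq ι]
    {P : Matrix ι ι ℝ} {π : ι → ℝ} (hrev : ∀ i j, π i * P i j = π j * P j i) :
    diagonal π * P = Pᵀ * diagonal π := by
  ext i j
  rw [diagonal_mul, mul_diagonal, transpose_apply, hrev, mul_comm]

open Matrix in
/-- For a reversible transition matrix `P`, the matrix `1 + P` is positive semidefinite with
respect to the `π`-inner product. -/
theorem posSemidef_diagonal_mul_one_add {ι : Type*} [Fintype ι] [DecidableEq ι]
    {P : Matrix ι ι ℝ} {π : ι → ℝ} (hP : ∀ i j, 0 ≤ P i j) (hrow : ∀ i, ∑ j, P i j = 1)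
    (hπ : ∀ i, 0 ≤ π i) (hrev : ∀ i j, π i * P i j = π j * P j i) :
    (diagonal π * (1 + P)).PosSemidef := by
  refine PosSemidef.of_dotProduct_mulVec_nonneg ?_ fun x => ?_
  · rw [IsHermitian, conjTranspose_eq_transpose_of_trivial, transpose_mul, diagonal_transpose,
      transpose_add, transpose_one, mul_add, add_mul, mul_one, one_mul,
      diagonal_mul_eq_transpose_mul_diagonal hrev]
  · rw [star_trivial, dotProduct_diagonal_mul_mulVec]
    have hleft : ∑ i, ∑ j, π i * P i j * x i ^ 2 = ∑ i, π i * x i ^ 2 := by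
      refine Finset.sum_congr rfl fun i _ => ?_
      rw [← Finset.sum_mul, ← Finset.mul_sum, hrow, mul_one]
    have hright : ∑ i, ∑ j, π i * P i j * x j ^ 2 = ∑ i, π i * x i ^ 2 := by
      rw [Finset.sum_comm, ← hleft]
      exact Finset.sum_congr rfl fun i _ => Finset.sum_congr rfl fun j _ => by rw [hrev]
    have hcross : ∑ i, π i * x i * ((1 + P) *ᵥ x) i =
        ∑ i, π i * x i ^ 2 + ∑ i, ∑ j, π i * P i j * (x i * x j) := by
      rw [← Finset.sum_add_distrib]
      refine Finset.sum_congr rfl fun i _ => ?_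
      rw [add_mulVec, one_mulVec, Pi.add_apply, mul_add, mulVec, dotProduct, Finset.mul_sum]
      congr 1
      · ring
      · exact Finset.sum_congr rfl fun j _ => by ring
    have hsq : ∑ i, ∑ j, π i * P i j * (x i + x j) ^ 2 =
        ∑ i, ∑ j, π i * P i j * x i ^ 2 + ∑ i, ∑ j, π i * P i j * x j ^ 2 +
          2 * ∑ i, ∑ j, π i * P i j * (x i * x j) := by
      simp only [Finset.mul_sum, ← Finset.sum_add_distrib]
      exact Finset.sum_congr rfl fun i _ => Finset.sum_congr rfl fun j _ => by ring
    have hnonneg : 0 ≤ ∑ i, ∑ j, π i * P i j * (x i + x j) ^ 2 :=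
      Finset.sum_nonneg fun i _ => Finset.sum_nonneg fun j _ =>
        mul_nonneg (mul_nonneg (hπ i) (hP i j)) (sq_nonneg _)
    linarith

open Matrix in
/-- Conjugating by `(1 - P) * P ^ k` for a matrix `P` that is self-adjoint for the
`π`-inner product. -/
theorem diagonal_mul_conj_one_sub_mul_pow {ι : Type*} [Fintype ι] [DecidableEq ι]
    {P : Matrix ι ι ℝ} {π : ι → ℝ} (hrev : ∀ i j, π i * P i j = π j * P j i)
    (A : Matrix ι ι ℝ) (k : ℕ) :
    ((1 - P) * P ^ k)ᴴ * (diagonal π * A) * ((1 - P) * P ^ k) =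
      diagonal π * (P ^ k * (1 - P) * A * ((1 - P) * P ^ k)) := by
  have hP : SemiconjBy (diagonal π) P Pᵀ := diagonal_mul_eq_transpose_mul_diagonal hrev
  have hB : diagonal π * (P ^ k * (1 - P)) = (Pᵀ ^ k * (1 - Pᵀ)) * diagonal π :=
    (hP.pow_right k).mul_right ((SemiconjBy.one_right _).sub_right hP)
  rw [conjTranspose_eq_transpose_of_trivial, transpose_mul, transpose_pow, transpose_sub,
    transpose_one, ← mul_assoc _ (diagonal π), ← hB]
  simp only [mul_assoc]

open Matrix Polynomial in
/-- For a reversible transition matrix `P`, the matrix `(1 - P) * (1 - P ^ m)` is positive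
semidefinite with respect to the `π`-inner product. -/
theorem posSemidef_diagonal_mul_one_sub_mul_one_sub_pow {ι : Type*} [Fintype ι] [DecidableEq ι]
    {P : Matrix ι ι ℝ} {π : ι → ℝ} (hP : ∀ i j, 0 ≤ P i j) (hrow : ∀ i, ∑ j, P i j = 1)
    (hπ : ∀ i, 0 ≤ π i) (hrev : ∀ i j, π i * P i j = π j * P j i) (m : ℕ) :
    (diagonal π * ((1 - P) * (1 - P ^ m))).PosSemidef := by
  have heven (k : ℕ) : (diagonal π * ((1 - P) * (1 - P ^ (2 * k)))).PosSemidef := by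
    induction k with
    | zero => simpa using PosSemidef.zero
    | succ k ih =>
      have h := (posSemidef_diagonal_mul_one_add hP hrow hπ hrev).conjTranspose_mul_mul_same
        ((1 - P) * P ^ k)
      rw [diagonal_mul_conj_one_sub_mul_pow hrev] at h
      convert ih.add h using 1
      rw [← mul_add]
      congr 1
      simpa only [map_mul, map_sub, map_add, map_one, map_pow, aeval_X] using
        congrArg (aeval P) (show (1 - X : ℤ[X]) * (1 - X ^ (2 * (k + 1))) =
          (1 - X) * (1 - X ^ (2 * k)) + X ^ k * (1 - X) * (1 + X) * ((1 - X) * X ^ k) by ring)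
  rcases m.even_or_odd' with ⟨k, rfl | rfl⟩
  · exact heven k
  · have h := (PosSemidef.diagonal (n := ι) (d := π) hπ).conjTranspose_mul_mul_same
      ((1 - P) * P ^ k)
    rw [← mul_one (diagonal π), diagonal_mul_conj_one_sub_mul_pow hrev] at h
    convert (heven k).add h using 1
    rw [← mul_add]
    congr 1
    simpa only [map_mul, map_sub, map_add, map_one, map_pow, aeval_X] using
      congrArg (aeval P) (show (1 - X : ℤ[X]) * (1 - X ^ (2 * k + 1)) =
        (1 - X) * (1 - X ^ (2 * k)) + X ^ k * (1 - X) * 1 * ((1 - X) * X ^ k) by ring)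


/-- For a reversible transition matrix `P` with stationary law `π`, the matrix
`(I - P)(I - P^{t-1})` is positive semidefinite with respect to the
π-inner product `⟨u, v⟩_π = ∑ i, π i * u i * v i`. -/
theorem stmt2 (n : ℕ) (hn : 1 ≤ n) (P : Matrix (Fin n) (Fin n) ℝ)
    (hP : ∀ i j, 0 ≤ P i j) (hrow : ∀ i, ∑ j, P i j = 1)
    (π : Fin n → ℝ) (hπ : ∀ i, 0 ≤ π i) (hπ1 : ∑ i, π i = 1)
    (hrev : ∀ i j, π i * P i j = π j * P j i)
    (t : ℕ) (ht : 1 ≤ t) (x : Fin n → ℝ) :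
    0 ≤ ∑ i, π i * x i * ((1 - P) * (1 - P ^ (t - 1))).mulVec x i := by
  have h := (posSemidef_diagonal_mul_one_sub_mul_one_sub_pow hP hrow hπ hrev
    (t - 1)).dotProduct_mulVec_nonneg x
  rwa [star_trivial, dotProduct_diagonal_mul_mulVec] at h
end

section
/- Let G be a simple graph on a vertex type V, let w be a walk in G from x to y, and let r be a natural number with 2r + 1 ≤ dist_G(x, y). Then the number of distinct vertices z in the support of w satisfying dist_G(x, z) > r and dist_G(z, y) > r is at least dist_G(x, y) − 2r − 1. -/
theorem SimpleGraph.Adj.dist_le_dist_add_one {V : Type*} {G : SimpleGraph V} {a b : V}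
    (hab : G.Adj a b) (x : V) : G.dist x b ≤ G.dist x a + 1 := by
  by_cases hr : G.Reachable x a
  · obtain ⟨p, hp⟩ := hr.exists_walk_length_eq_dist
    simpa [hp] using SimpleGraph.dist_le (p.concat hab)
  · have hb : ¬ G.Reachable x b := fun hb => hr (hb.trans hab.symm.reachable)
    simp [SimpleGraph.dist_eq_zero_of_not_reachable hb]

theorem SimpleGraph.Reachable.dist_le_dist_add_dist {V : Type*} {G : SimpleGraph V} {x y z : V}
    (hxz : G.Reachable x z) (hzy : G.Reachable z y) :
    G.dist x y ≤ G.dist x z + G.dist z y := by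
  obtain ⟨p, hp⟩ := hxz.exists_walk_length_eq_dist
  obtain ⟨q, hq⟩ := hzy.exists_walk_length_eq_dist
  simpa [hp, hq] using SimpleGraph.dist_le (p.append q)

/-- Discrete intermediate value theorem along a walk. -/
theorem SimpleGraph.Walk.exists_mem_support_eq {V : Type*} {G : SimpleGraph V} {f : V → ℕ}
    (hf : ∀ a b, G.Adj a b → f b ≤ f a + 1) {u v : V} (w : G.Walk u v) {k : ℕ}
    (hu : f u ≤ k) (hv : k ≤ f v) : ∃ z ∈ w.support, f z = k := by
  induction w with
  | nil => exact ⟨_, by simp, le_antisymm hu hv⟩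
  | @cons a b c hab p ih =>
    rcases hu.eq_or_lt with hu | hu
    · exact ⟨a, by simp, hu⟩
    · obtain ⟨z, hz, hzk⟩ := ih ((hf a b hab).trans hu) hv
      exact ⟨z, by simp [hz], hzk⟩

/-- Any walk from `x` to `y` contains at least `dist x y - 2r - 1` distinct
vertices at graph distance more than `r` from both endpoints. -/
theorem stmt4 {V : Type*} (G : SimpleGraph V) {x y : V} (w : G.Walk x y)
    (r : ℕ) (h : 2 * r + 1 ≤ G.dist x y) :
    (G.dist x y - 2 * r - 1 : ℕ) ≤
      {z : V | z ∈ w.support ∧ r < G.dist x z ∧ r < G.dist z y}.ncard := by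
  classical
  set S := {z : V | z ∈ w.support ∧ r < G.dist x z ∧ r < G.dist z y}
  have hS : S.Finite := w.support.finite_toSet.subset fun z hz => hz.1
  have hsub : Set.Ioo r (G.dist x y - r) ⊆ G.dist x '' S := by
    rintro k ⟨hrk, hkr⟩
    obtain ⟨z, hz, rfl⟩ := w.exists_mem_support_eq (f := G.dist x) (k := k)
      (fun a b hab => hab.dist_le_dist_add_one x) (by simp) (by omega)
    have := (w.takeUntil z hz).reachable.dist_le_dist_add_dist (w.dropUntil z hz).reachable
    exact ⟨z, ⟨hz, hrk, by omega⟩, rfl⟩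
  calc G.dist x y - 2 * r - 1 = (Set.Ioo r (G.dist x y - r)).ncard := by
        rw [← Finset.coe_Ioo, Set.ncard_coe_finset, Nat.card_Ioo]
        omega
    _ ≤ (G.dist x '' S).ncard := Set.ncard_le_ncard hsub (hS.image _)
    _ ≤ S.ncard := Set.ncard_image_le hS
end

section
/- Let G be a simple graph on a vertex type V, let S be a set of vertices, and let p be a path (a walk with no repeated vertices) in G from x to y. Suppose z is a vertex on p with z ∈ S, and suppose that the subpath of p from x to z contains a vertex not in S and the subpath of p from z to y contains a vertex not in S. Then there exist walks q₁ and q₂ in G, both starting at z, with q₁ ending at some vertex u₁ ∉ S and q₂ ending at some vertex u₂ ∉ S, such that every vertex of q₁ other than its final vertex lies in S, every vertex of q₂ other than its final vertex lies in S, and the supports of q₁ and q₂ intersect exactly in {z}. (In the paper's terminology, z belongs to the backbone B_G[S].) -/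
/-- A walk that leaves `S` can be stopped at its first vertex outside `S`. -/
theorem SimpleGraph.Walk.exists_walk_support_dropLast_subset {V : Type*} {G : SimpleGraph V}
    (S : Set V) {a b : V} (w : G.Walk a b) (h : ∃ c ∈ w.support, c ∉ S) :
    ∃ (u : V) (q : G.Walk a u), u ∉ S ∧ (∀ v ∈ q.support.dropLast, v ∈ S) ∧
      q.support ⊆ w.support := by
  induction w with
  | nil => exact ⟨_, .nil, by simpa using h, by simp, by simp⟩
  | @cons a' b' c' hadj w ih =>
    by_cases ha : a' ∈ S
    · obtain ⟨c, hc, hcS⟩ := h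
      have hcw : c ∈ w.support := by
        rcases List.mem_cons.1 hc with rfl | hc
        · exact absurd ha hcS
        · exact hc
      obtain ⟨u, q, hu, hq, hsub⟩ := ih ⟨c, hcw, hcS⟩
      refine ⟨u, .cons hadj q, hu, ?_, ?_⟩
      · rw [support_cons, List.dropLast_cons_of_ne_nil q.support_ne_nil]
        simpa [ha] using hq
      · exact List.cons_subset_cons _ hsub
    · exact ⟨a', .nil, ha, by simp, by simp⟩

/-- A vertex of a path is the only vertex common to the two subpaths it separates. -/
theorem SimpleGraph.Walk.IsPath.eq_of_mem_takeUntil_of_mem_dropUntil {V : Type*} [DecidableEq V]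
    {G : SimpleGraph V} {x y z v : V} {p : G.Walk x y} (hp : p.IsPath) (hz : z ∈ p.support)
    (hv₁ : v ∈ (p.takeUntil z hz).support) (hv₂ : v ∈ (p.dropUntil z hz).support) : v = z := by
  have hnd := hp.support_nodup
  rw [← p.take_spec hz, support_append] at hnd
  rw [← cons_tail_support, List.mem_cons] at hv₂
  exact hv₂.resolve_right fun hv => (List.nodup_append'.1 hnd).2.2 hv₁ hv

/-- If `p` is a path from `x` to `y` through a vertex `z ∈ S`, and both the
subpath from `x` to `z` and the subpath from `z` to `y` leave `S`, then `z` is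
in the backbone `B_G[S]`: there are two walks from `z`, each ending outside `S`
with all other vertices in `S`, whose supports meet only in `{z}`. -/
theorem stmt5 {V : Type*} [DecidableEq V] (G : SimpleGraph V) (S : Set V) {x y : V}
    (p : G.Walk x y) (hp : p.IsPath) (z : V) (hz : z ∈ p.support) (hzS : z ∈ S)
    (h1 : ∃ a ∈ (p.takeUntil z hz).support, a ∉ S)
    (h2 : ∃ b ∈ (p.dropUntil z hz).support, b ∉ S) :
    ∃ (u₁ u₂ : V) (q₁ : G.Walk z u₁) (q₂ : G.Walk z u₂),
      u₁ ∉ S ∧ u₂ ∉ S ∧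
      (∀ v ∈ q₁.support.dropLast, v ∈ S) ∧
      (∀ v ∈ q₂.support.dropLast, v ∈ S) ∧
      {v : V | v ∈ q₁.support} ∩ {v : V | v ∈ q₂.support} = {z} := by
  obtain ⟨u₁, q₁, hu₁, hq₁, hs₁⟩ :=
    (p.takeUntil z hz).reverse.exists_walk_support_dropLast_subset S (by simpa using h1)
  obtain ⟨u₂, q₂, hu₂, hq₂, hs₂⟩ := (p.dropUntil z hz).exists_walk_support_dropLast_subset S h2
  refine ⟨u₁, u₂, q₁, q₂, hu₁, hu₂, hq₁, hq₂, Set.Subset.antisymm ?_ ?_⟩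
  · rintro v ⟨hv₁, hv₂⟩
    exact hp.eq_of_mem_takeUntil_of_mem_dropUntil hz (by simpa using hs₁ hv₁) (hs₂ hv₂)
  · rintro v rfl
    exact ⟨q₁.start_mem_support, q₂.start_mem_support⟩
end

section
/- Let G be a simple graph on a vertex type V, let ω : V → ℝ be nonnegative, let B ⊆ V, let c ≥ 0 satisfy ω z ≥ c for all z ∈ B, and let m be a natural number. Suppose that every path in G from x to y contains at least m vertices of B that are distinct from x and y. Then every walk in G from x to y has ω-length at least c·m; in particular dist_ω(x, y) ≥ c·m. -/
/-- The `ω`-length of a walk: the sum over its edges `{u, v}` of `(ω u + ω v)/2`. -/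
noncomputable def walkLen {V : Type*} (G : SimpleGraph V) (ω : V → ℝ)
    {x y : V} (w : G.Walk x y) : ℝ :=
  (w.darts.map (fun d => (ω d.toProd.1 + ω d.toProd.2) / 2)).sum

theorem walkLen_add_half_endpoints {V : Type*} (G : SimpleGraph V) (ω : V → ℝ) {x y : V}
    (w : G.Walk x y) : walkLen G ω w + (ω x + ω y) / 2 = (w.support.map ω).sum := by
  induction w with
  | nil => simp [walkLen]
  | cons h p ih =>
    simp only [walkLen, SimpleGraph.Walk.darts_cons, SimpleGraph.Walk.support_cons,
      List.map_cons, List.sum_cons] at ih ⊢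
    linarith

theorem walkLen_nonneg {V : Type*} (G : SimpleGraph V) {ω : V → ℝ} (hω : ∀ v, 0 ≤ ω v)
    {x y : V} (w : G.Walk x y) : 0 ≤ walkLen G ω w := by
  refine List.sum_nonneg fun a ha => ?_
  obtain ⟨d, -, rfl⟩ := List.mem_map.1 ha
  linarith [hω d.toProd.1, hω d.toProd.2]

theorem List.sum_toFinset_le_sum_map {V : Type*} [DecidableEq V] {ω : V → ℝ}
    (hω : ∀ v, 0 ≤ ω v) (l : List V) : ∑ v ∈ l.toFinset, ω v ≤ (l.map ω).sum := by
  induction l with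
  | nil => simp
  | cons a l ih =>
    rw [List.toFinset_cons, List.map_cons, List.sum_cons]
    by_cases ha : a ∈ l.toFinset
    · rw [Finset.insert_eq_of_mem ha]
      linarith [hω a]
    · rw [Finset.sum_insert ha]
      linarith

/-- If every path from `x` to `y` contains at least `m` vertices of `B`
distinct from `x` and `y`, and `ω ≥ c ≥ 0` on `B`, then every walk from `x` to
`y` has `ω`-length at least `c * m`; in particular `dist_ω(x,y) ≥ c * m`. -/
theorem stmt6 {V : Type*} (G : SimpleGraph V) (ω : V → ℝ) (hω : ∀ v, 0 ≤ ω v)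
    (B : Set V) (c : ℝ) (hc : 0 ≤ c) (hB : ∀ z ∈ B, c ≤ ω z) (m : ℕ)
    (x y : V)
    (hpaths : ∀ p : G.Walk x y, p.IsPath →
      m ≤ {z : V | z ∈ p.support ∧ z ∈ B ∧ z ≠ x ∧ z ≠ y}.ncard) :
    (∀ w : G.Walk x y, c * m ≤ walkLen G ω w) ∧
      ENNReal.ofReal (c * m) ≤ ⨅ w : G.Walk x y, ENNReal.ofReal (walkLen G ω w) := by
  classical
  have hlen : ∀ w : G.Walk x y, c * m ≤ walkLen G ω w := by
    intro w
    rcases eq_or_ne x y with rfl | hxy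
    · have hm : m = 0 := by
        have h := hpaths .nil .nil
        have he : {z : V | z ∈ (SimpleGraph.Walk.nil : G.Walk x x).support ∧
            z ∈ B ∧ z ≠ x ∧ z ≠ x} = ∅ := by
          ext z
          simp +contextual
        rw [he, Set.ncard_empty] at h
        exact Nat.le_zero.1 h
      simpa only [hm, Nat.cast_zero, mul_zero] using walkLen_nonneg G hω w
    · set S := w.support.toFinset.filter (fun z => z ∈ B ∧ z ≠ x ∧ z ≠ y) with hS
      have hmS : m ≤ S.card := by
        refine (hpaths w.bypass w.bypass_isPath).trans ?_
        rw [← Set.ncard_coe_finset]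
        refine Set.ncard_le_ncard (fun z hz => ?_) S.finite_toSet
        simpa [hS] using ⟨w.support_bypass_subset_support hz.1, hz.2⟩
      have hxS : x ∉ insert y S := by simp [hS, hxy]
      have hyS : y ∉ S := by simp [hS]
      have hsub : insert x (insert y S) ⊆ w.support.toFinset := by
        intro z hz
        simp only [Finset.mem_insert] at hz
        rcases hz with rfl | rfl | hz
        · simp
        · simp
        · exact (Finset.mem_filter.1 hz).1
      have hsum := Finset.sum_le_sum_of_subset_of_nonneg hsub fun v _ _ => hω v
      rw [Finset.sum_insert hxS, Finset.sum_insert hyS] at hsum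
      have hSsum : S.card • c ≤ ∑ v ∈ S, ω v :=
        Finset.card_nsmul_le_sum _ _ _ fun z hz => hB z (Finset.mem_filter.1 hz).2.1
      rw [nsmul_eq_mul, mul_comm] at hSsum
      have hcm : c * m ≤ c * S.card := by gcongr
      linarith [walkLen_add_half_endpoints G ω w, List.sum_toFinset_le_sum_map hω w.support,
        hω x, hω y]
  exact ⟨hlen, le_iInf fun w => ENNReal.ofReal_le_ofReal (hlen w)⟩
end

section
/- Let G be a simple graph on a countable vertex type V, let μ be a probability measure on V, and for each integer j ≥ 1 let ω_j : V → ℝ be nonnegative with ∫ ω_j² dμ ≤ 1. Assume that for each v ∈ V the series ∑_{j≥1} ω_j(v)²/j² converges, and define ω(v) := √( (6/π²) · ∑_{j≥1} ω_j(v)²/j² ). Then (i) ∫ ω² dμ ≤ 1, and (ii) for every j ≥ 1 and all x, y ∈ V, dist_ω(x, y) ≥ (√6 / (π · j)) · dist_{ω_j}(x, y). -/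
open MeasureTheory

/-- The conformal distance `dist_ω(x,y)`: the infimum of `ω`-lengths over all
walks from `x` to `y` (equal to `∞` when there is no such walk). -/
noncomputable def wdist {V : Type*} (G : SimpleGraph V) (ω : V → ℝ) (x y : V) : ENNReal :=
  ⨅ w : G.Walk x y, ENNReal.ofReal (walkLen G ω w)

/-- The `ω`-length of a walk is monotone in the weight, up to a constant factor. -/
theorem mul_walkLen_le {V : Type*} {G : SimpleGraph V} {ω ω' : V → ℝ} {c : ℝ}
    (h : ∀ v, c * ω v ≤ ω' v) {x y : V} (w : G.Walk x y) :
    c * walkLen G ω w ≤ walkLen G ω' w := by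
  unfold walkLen
  rw [← List.sum_map_mul_left]
  refine List.sum_le_sum fun d _ => ?_
  linarith [h d.toProd.1, h d.toProd.2]

/-- The conformal distance is monotone in the weight, up to a nonnegative constant factor. -/
theorem ofReal_mul_wdist_le {V : Type*} {G : SimpleGraph V} {ω ω' : V → ℝ} {c : ℝ}
    (hc : 0 ≤ c) (h : ∀ v, c * ω v ≤ ω' v) (x y : V) :
    ENNReal.ofReal c * wdist G ω x y ≤ wdist G ω' x y := by
  refine le_iInf fun w => ?_
  calc ENNReal.ofReal c * wdist G ω x y
      ≤ ENNReal.ofReal c * ENNReal.ofReal (walkLen G ω w) := by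
        gcongr
        exact iInf_le _ w
    _ = ENNReal.ofReal (c * walkLen G ω w) := (ENNReal.ofReal_mul hc).symm
    _ ≤ ENNReal.ofReal (walkLen G ω' w) := ENNReal.ofReal_le_ofReal (mul_walkLen_le h w)

theorem hasSum_one_div_succ_sq :
    HasSum (fun j : ℕ => 1 / ((j : ℝ) + 1) ^ 2) (Real.pi ^ 2 / 6) := by
  have h := (hasSum_nat_add_iff' 1).mpr hasSum_zeta_two
  simpa using h

/-- If nonnegative functions have integral at most one, so does their average with weights
proportional to `1 / j ^ 2`. No integrability is required of the functions themselves: it follows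
from that of the average, and the integral of a non-integrable average is zero. -/
theorem integral_six_div_pi_sq_mul_tsum_le_one {α : Type*} [MeasurableSpace α] {μ : Measure α}
    {f : ℕ → α → ℝ} (hf : ∀ j, AEStronglyMeasurable (f j) μ) (hf0 : ∀ j a, 0 ≤ f j a)
    (hint : ∀ j, ∫ a, f j a ∂μ ≤ 1)
    (hsum : ∀ a, Summable fun j : ℕ => f j a / ((j : ℝ) + 1) ^ 2) :
    ∫ a, 6 / Real.pi ^ 2 * ∑' j : ℕ, f j a / ((j : ℝ) + 1) ^ 2 ∂μ ≤ 1 := by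
  have hpi : 0 < 6 / Real.pi ^ 2 := by positivity
  have hterm : ∀ (j : ℕ) a, 0 ≤ f j a / ((j : ℝ) + 1) ^ 2 := fun j a =>
    div_nonneg (hf0 j a) (by positivity)
  rw [integral_const_mul]
  by_cases hI : Integrable (fun a => ∑' j : ℕ, f j a / ((j : ℝ) + 1) ^ 2) μ
  · have hFi : ∀ j : ℕ, Integrable (fun a => f j a / ((j : ℝ) + 1) ^ 2) μ := fun j => by
      refine hI.mono' (by simpa only [div_eq_mul_inv] using (hf j).mul_const _)
        (Filter.Eventually.of_forall fun a => ?_)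
      rw [Real.norm_of_nonneg (hterm j a)]
      exact (hsum a).le_tsum j fun i _ => hterm i a
    have hle : ∀ j : ℕ, ∫ a, f j a / ((j : ℝ) + 1) ^ 2 ∂μ ≤ 1 / ((j : ℝ) + 1) ^ 2 := fun j => by
      rw [integral_div]
      gcongr
      exact hint j
    have hS : Summable fun j : ℕ => ∫ a, f j a / ((j : ℝ) + 1) ^ 2 ∂μ :=
      hasSum_one_div_succ_sq.summable.of_nonneg_of_le (fun j => integral_nonneg (hterm j)) hle
    have hsumInt := hasSum_integral_of_summable_integral_norm hFi
      (by simpa only [Real.norm_of_nonneg (hterm _ _)] using hS)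
    calc 6 / Real.pi ^ 2 * ∫ a, ∑' j : ℕ, f j a / ((j : ℝ) + 1) ^ 2 ∂μ
        ≤ 6 / Real.pi ^ 2 * (Real.pi ^ 2 / 6) := by
          gcongr
          exact hasSum_le hle hsumInt hasSum_one_div_succ_sq
      _ = 1 := by field_simp
  · simp [integral_undef hI]

/-- Combining conformal weights `ω_j` with `∫ ω_j² dμ ≤ 1` into a single weight
`ω = √((6/π²) ∑_{j≥1} ω_j²/j²)`: then `∫ ω² dμ ≤ 1` and
`dist_ω ≥ (√6/(π j)) · dist_{ω_j}` for each `j ≥ 1`. -/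
theorem stmt7 {V : Type*} [Countable V] [MeasurableSpace V] [MeasurableSingletonClass V]
    (G : SimpleGraph V) (μ : Measure V) [IsProbabilityMeasure μ]
    (ω : ℕ → V → ℝ) (hω : ∀ j, 1 ≤ j → ∀ v, 0 ≤ ω j v)
    (hint : ∀ j, 1 ≤ j → ∫ v, (ω j v) ^ 2 ∂μ ≤ 1)
    (hsum : ∀ v, Summable (fun j : ℕ => (ω (j + 1) v) ^ 2 / ((j : ℝ) + 1) ^ 2)) :
    (∫ v, (Real.sqrt ((6 / Real.pi ^ 2) *
        ∑' j : ℕ, (ω (j + 1) v) ^ 2 / ((j : ℝ) + 1) ^ 2)) ^ 2 ∂μ ≤ 1) ∧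
    (∀ j : ℕ, 1 ≤ j → ∀ x y : V,
      ENNReal.ofReal (Real.sqrt 6 / (Real.pi * j)) * wdist G (ω j) x y ≤
        wdist G (fun v => Real.sqrt ((6 / Real.pi ^ 2) *
          ∑' i : ℕ, (ω (i + 1) v) ^ 2 / ((i : ℝ) + 1) ^ 2)) x y) := by
  have hterm : ∀ (j : ℕ) v, 0 ≤ (ω (j + 1) v) ^ 2 / ((j : ℝ) + 1) ^ 2 := fun j v => by positivity
  constructor
  · have hsq : ∀ v, Real.sqrt ((6 / Real.pi ^ 2) *
        ∑' j : ℕ, (ω (j + 1) v) ^ 2 / ((j : ℝ) + 1) ^ 2) ^ 2 =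
        (6 / Real.pi ^ 2) * ∑' j : ℕ, (ω (j + 1) v) ^ 2 / ((j : ℝ) + 1) ^ 2 := fun v =>
      Real.sq_sqrt (mul_nonneg (by positivity) (tsum_nonneg fun j => hterm j v))
    simp only [hsq]
    exact integral_six_div_pi_sq_mul_tsum_le_one
      (fun j => Measurable.of_discrete.aestronglyMeasurable) (fun j v => sq_nonneg (ω (j + 1) v))
      (fun j => hint (j + 1) (by omega)) hsum
  · intro j hj x y
    refine ofReal_mul_wdist_le (by positivity) (fun v => Real.le_sqrt_of_sq_le ?_) x y
    obtain ⟨k, rfl⟩ := Nat.exists_eq_add_of_le' hj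
    calc (Real.sqrt 6 / (Real.pi * (k + 1 : ℕ)) * ω (k + 1) v) ^ 2
        = 6 / Real.pi ^ 2 * ((ω (k + 1) v) ^ 2 / ((k : ℝ) + 1) ^ 2) := by
          rw [mul_pow, div_pow, Real.sq_sqrt (by norm_num)]
          push_cast
          field_simp
      _ ≤ 6 / Real.pi ^ 2 * ∑' i : ℕ, (ω (i + 1) v) ^ 2 / ((i : ℝ) + 1) ^ 2 := by
          gcongr
          exact (hsum v).le_tsum k fun i _ => hterm i v
end

section
/- Let 𝒢 be a simple graph on a vertex type V and let G be a subgraph of 𝒢 on the same vertex set (every edge of G is an edge of 𝒢). Let 𝒞 be a collection of subsets of V, let N ≥ 1 be a natural number and α ≥ 0 a real number such that: every S ∈ 𝒞 is finite with |S| ≤ N, and for every v ∈ V there exists S ∈ 𝒞 with B_𝒢(v, α) ⊆ S. Then for all vertices x, y in the same connected component of G and every path γ in G from x to y, the number of distinct vertices z on γ for which there exists S ∈ 𝒞 with B_𝒢(z, α) ⊆ S and z ∈ B_G[S] is at least dist_G(x, y) − 2N − 1. -/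
/-- The backbone `B_G[S]`: vertices `z ∈ S` admitting two walks in `G` starting
at `z`, each ending at a vertex outside `S` with all their other vertices in
`S`, whose supports intersect only in `{z}`. -/
def Backbone {V : Type*} (G : SimpleGraph V) (S : Set V) : Set V :=
  { z | z ∈ S ∧ ∃ (u₁ u₂ : V) (q₁ : G.Walk z u₁) (q₂ : G.Walk z u₂),
      u₁ ∉ S ∧ u₂ ∉ S ∧
      (∀ v ∈ q₁.support.dropLast, v ∈ S) ∧
      (∀ v ∈ q₂.support.dropLast, v ∈ S) ∧
      { v : V | v ∈ q₁.support } ∩ { v : V | v ∈ q₂.support } = {z} }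

/-- The closed ball `B_𝒢(v, α) = { u : dist_𝒢(v, u) ≤ α }` in the graph metric. -/
def gball {V : Type*} (𝒢 : SimpleGraph V) (v : V) (α : ℝ) : Set V :=
  { u | 𝒢.Reachable v u ∧ (𝒢.dist v u : ℝ) ≤ α }

open SimpleGraph

theorem SimpleGraph.Walk.exists_walk_to_first_notMem {V : Type*} {G : SimpleGraph V} {S : Set V}
    {z w : V} (p : G.Walk z w) (h : ∃ v ∈ p.support, v ∉ S) :
    ∃ (u : V) (q : G.Walk z u), u ∉ S ∧ (∀ v ∈ q.support.dropLast, v ∈ S) ∧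
      q.support ⊆ p.support := by
  induction p with
  | @nil a => exact ⟨a, .nil, by simpa using h, by simp, by simp⟩
  | @cons a b c hab p ih =>
    by_cases ha : a ∈ S
    · obtain ⟨v, hv, hvS⟩ := h
      rw [Walk.support_cons, List.mem_cons] at hv
      have hvp : v ∈ p.support := hv.resolve_left (by rintro rfl; exact hvS ha)
      obtain ⟨u, q, huS, hq, hqp⟩ := ih ⟨v, hvp, hvS⟩
      refine ⟨u, .cons hab q, huS, ?_, ?_⟩
      · rw [Walk.support_cons, List.dropLast_cons_of_ne_nil q.support_ne_nil]
        simpa [ha] using hq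
      · rw [Walk.support_cons, Walk.support_cons]
        exact List.cons_subset_cons a hqp
    · exact ⟨a, .nil, ha, by simp, by simp⟩

theorem SimpleGraph.Walk.IsPath.length_lt_ncard {V : Type*} {G : SimpleGraph V} {S : Set V}
    {u v : V} {p : G.Walk u v} (hp : p.IsPath) (hS : S.Finite) (h : ∀ w ∈ p.support, w ∈ S) :
    p.length < S.ncard := by
  classical
  have hcard : p.support.toFinset.card = p.length + 1 := by
    rw [List.toFinset_card_of_nodup hp.support_nodup, Walk.length_support]
  have hle : (p.support.toFinset : Set V).ncard ≤ S.ncard :=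
    Set.ncard_le_ncard (fun w hw => h w (by simpa using hw)) hS
  rw [Set.ncard_coe_finset] at hle
  omega

theorem SimpleGraph.Walk.exists_mem_support_dist_eq {V : Type*} {G : SimpleGraph V} {x u w : V}
    (p : G.Walk u w) {k : ℕ} (hu : G.dist x u ≤ k) (hw : k ≤ G.dist x w) :
    ∃ z ∈ p.support, G.dist x z = k := by
  induction p with
  | @nil a => exact ⟨a, by simp, le_antisymm hu hw⟩
  | @cons a b c hab p ih =>
    rcases hu.eq_or_lt with hu | hu
    · exact ⟨a, by simp, hu⟩
    · have hstep := hab.reachable.dist_triangle_right x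
      rw [dist_eq_one_iff_adj.mpr hab] at hstep
      obtain ⟨z, hz, hzk⟩ := ih (by omega) hw
      exact ⟨z, by simp [hz], hzk⟩

theorem mem_Backbone_of_isPath_append {V : Type*} {G : SimpleGraph V} {S : Set V} {x y z : V}
    {p : G.Walk x z} {q : G.Walk z y} (hpq : (p.append q).IsPath) (hz : z ∈ S)
    (hp : ∃ v ∈ p.support, v ∉ S) (hq : ∃ v ∈ q.support, v ∉ S) : z ∈ Backbone G S := by
  obtain ⟨u₁, q₁, hu₁, hq₁, hs₁⟩ :=
    p.reverse.exists_walk_to_first_notMem (S := S) (by simpa using hp)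
  obtain ⟨u₂, q₂, hu₂, hq₂, hs₂⟩ := q.exists_walk_to_first_notMem hq
  refine ⟨hz, u₁, u₂, q₁, q₂, hu₁, hu₂, hq₁, hq₂, ?_⟩
  ext v
  simp only [Set.mem_inter_iff, Set.mem_ofPred_eq, Set.mem_singleton_iff]
  constructor
  · rintro ⟨hv₁, hv₂⟩
    have hvp : v ∈ p.support := by simpa using hs₁ hv₁
    have hvq : v ∈ q.support := hs₂ hv₂
    have hnd := hpq.support_nodup
    rw [Walk.support_append] at hnd
    rw [← Walk.cons_tail_support, List.mem_cons] at hvq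
    exact hvq.resolve_right fun hv => (List.disjoint_of_nodup_append hnd) hvp hv
  · rintro rfl
    simp

theorem mem_Backbone_of_ncard_le_dist {V : Type*} {G : SimpleGraph V} {S : Set V} {x y z : V}
    {γ : G.Walk x y} (hγ : γ.IsPath) (hzγ : z ∈ γ.support) (hS : S.Finite) (hz : z ∈ S)
    (hx : S.ncard ≤ G.dist x z) (hy : S.ncard ≤ G.dist z y) : z ∈ Backbone G S := by
  obtain ⟨p, q, rfl⟩ := Walk.mem_support_iff_exists_append.mp hzγ
  refine mem_Backbone_of_isPath_append hγ hz ?_ ?_ <;> by_contra! h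
  · have := hγ.of_append_left.length_lt_ncard hS h
    have := dist_le p
    omega
  · have := hγ.of_append_right.length_lt_ncard hS h
    have := dist_le q
    omega

/-- If each member of the cover `𝒞` has at most `N` vertices and every
`𝒢`-ball of radius `α` is contained in some member, then every path in `G`
from `x` to `y` contains at least `dist_G(x,y) - 2N - 1` distinct vertices `z`
lying in the backbone `B_G[S]` of some `S ∈ 𝒞` containing `B_𝒢(z, α)`. -/
theorem stmt11 {V : Type*} (𝒢 G : SimpleGraph V) (hle : G ≤ 𝒢)
    (𝒞 : Set (Set V)) (N : ℕ) (hN : 1 ≤ N) (α : ℝ) (hα : 0 ≤ α)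
    (hfin : ∀ S ∈ 𝒞, S.Finite ∧ S.ncard ≤ N)
    (hpad : ∀ v : V, ∃ S ∈ 𝒞, gball 𝒢 v α ⊆ S)
    (x y : V) (hxy : G.Reachable x y) (γ : G.Walk x y) (hγ : γ.IsPath) :
    (G.dist x y - 2 * N - 1 : ℕ) ≤
      { z : V | z ∈ γ.support ∧ ∃ S ∈ 𝒞, gball 𝒢 z α ⊆ S ∧ z ∈ Backbone G S }.ncard := by
  set A := { z : V | z ∈ γ.support ∧ ∃ S ∈ 𝒞, gball 𝒢 z α ⊆ S ∧ z ∈ Backbone G S }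
  have hA : A.Finite := γ.support.finite_toSet.subset fun z hz => hz.1
  have hsub : Set.Icc N (G.dist x y - N) ⊆ G.dist x '' A := by
    rintro k ⟨hNk, hkD⟩
    obtain ⟨z, hz, rfl⟩ := γ.exists_mem_support_dist_eq (x := x) (k := k) (by simp) (by omega)
    obtain ⟨S, hS, hball⟩ := hpad z
    have hzS : z ∈ S := hball ⟨.refl z, by simpa using hα⟩
    obtain ⟨hSfin, hSN⟩ := hfin S hS
    obtain ⟨p, -, -⟩ := Walk.mem_support_iff_exists_append.mp hz
    have htri := p.reachable.dist_triangle_left y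
    exact ⟨z, ⟨hz, S, hS, hball, mem_Backbone_of_ncard_le_dist hγ hz hSfin hzS
      (by omega) (by omega)⟩, rfl⟩
  have hcard := (Set.ncard_le_ncard hsub (hA.image _)).trans (Set.ncard_image_le hA)
  rw [← Finset.coe_Icc, Set.ncard_coe_finset, Nat.card_Icc] at hcard
  omega
end

section
/- Let 𝒢 be a simple graph on a vertex type V and let G be a subgraph of 𝒢 on the same vertex set. Let 𝒞 be a collection of subsets of V, let N ≥ 1 be a natural number and α ≥ 0 a real number such that every S ∈ 𝒞 is finite with |S| ≤ N and for every v ∈ V there exists S ∈ 𝒞 with B_𝒢(v, α) ⊆ S. Call S ⊆ V α-deep (in G) if there exists v ∈ S with B_𝒢(v, α) ⊆ S and a walk in G from v ending at a vertex outside S with all of its other vertices in S. Let B° be the union of the backbones B_G[S] over all α-deep S ∈ 𝒞, let c ≥ 0, and let ω := c · 1_{B°}. Then for all x, y in the same connected component of G, dist_ω(x, y) ≥ c · (dist_G(x, y) − 2N − 1). -/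
/-- `S` is `α`-deep in `G`: some `v ∈ S` has `B_𝒢(v, α) ⊆ S` and is connected
inside `S` to the exterior of `S`, i.e., there is a walk in `G` from `v`
ending at a vertex outside `S` with all of its other vertices in `S`. -/
def Deep {V : Type*} (𝒢 G : SimpleGraph V) (α : ℝ) (S : Set V) : Prop :=
  ∃ v ∈ S, gball 𝒢 v α ⊆ S ∧
    ∃ (u : V) (w : G.Walk v u), u ∉ S ∧ ∀ z ∈ w.support.dropLast, z ∈ S

namespace SimpleGraph.Walk

variable {V : Type*} {G : SimpleGraph V}

/-- A walk meeting the complement of `S` can be stopped at its first exit from `S`. -/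
lemma exists_first_exit (S : Set V) {x y : V} (w : G.Walk x y) (h : ∃ v ∈ w.support, v ∉ S) :
    ∃ (u : V) (q : G.Walk x u), u ∉ S ∧ (∀ v ∈ q.support.dropLast, v ∈ S) ∧
      q.support ⊆ w.support := by
  induction w with
  | nil =>
    obtain ⟨v, hv, hvS⟩ := h
    obtain rfl : v = _ := by simpa using hv
    exact ⟨v, .nil, hvS, by simp, by simp⟩
  | @cons a b d hab p ih =>
    by_cases ha : a ∈ S
    · obtain ⟨v, hv, hvS⟩ := h
      have hv' : v ∈ p.support := by
        rw [support_cons, List.mem_cons] at hv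
        exact hv.resolve_left fun e => hvS (e ▸ ha)
      obtain ⟨u, q, hu, hq, hsub⟩ := ih ⟨v, hv', hvS⟩
      refine ⟨u, .cons hab q, hu, ?_, ?_⟩
      · rw [support_cons, List.dropLast_cons_of_ne_nil q.support_ne_nil]
        simpa [ha] using hq
      · exact List.cons_subset_cons a hsub
    · exact ⟨a, .nil, ha, by simp, by simp⟩

/-- A path of length at least `N` leaves every set with at most `N` elements. -/
lemma IsPath.exists_notMem_of_ncard_le {S : Set V} (hS : S.Finite) {x y : V} {w : G.Walk x y}
    (hw : w.IsPath) (h : S.ncard ≤ w.length) : ∃ v ∈ w.support, v ∉ S := by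
  classical
  by_contra! hsub
  have h1 : w.support.toFinset.card = w.length + 1 := by
    rw [List.toFinset_card_of_nodup hw.support_nodup, length_support]
  have h2 : w.support.toFinset.card ≤ S.ncard := by
    rw [← Set.ncard_coe_finset]
    exact Set.ncard_le_ncard (fun v hv => hsub v (by simpa using hv)) hS
  omega

/-- A vertex of a path that is far from both ends, measured along the path, lies in the backbone
of every small set containing it, and is connected to the exterior inside that set. -/
lemma IsPath.getVert_mem_backbone {S : Set V} (hS : S.Finite) {x y : V} {p : G.Walk x y}
    (hp : p.IsPath) {i : ℕ} (h1 : S.ncard ≤ i) (h2 : i + S.ncard ≤ p.length)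
    (hi : p.getVert i ∈ S) :
    p.getVert i ∈ Backbone G S ∧ ∃ (u : V) (w : G.Walk (p.getVert i) u), u ∉ S ∧
      ∀ z ∈ w.support.dropLast, z ∈ S := by
  obtain ⟨u₁, q₁, hu₁, hq₁, hs₁⟩ := exists_first_exit S (p.drop i)
    ((hp.drop i).exists_notMem_of_ncard_le hS (by rw [drop_length]; omega))
  obtain ⟨u₂, q₂, hu₂, hq₂, hs₂⟩ := exists_first_exit S (p.take i).reverse
    ((hp.take i).reverse.exists_notMem_of_ncard_le hS
      (by rw [length_reverse, take_length]; omega))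
  refine ⟨⟨hi, u₁, u₂, q₁, q₂, hu₁, hu₂, hq₁, hq₂, ?_⟩, u₁, q₁, hu₁, hq₁⟩
  ext v
  simp only [Set.mem_inter_iff, Set.mem_ofPred_eq, Set.mem_singleton_iff]
  refine ⟨fun ⟨hv₁, hv₂⟩ => ?_,
    fun h => ⟨by simp [h], by simp [h]⟩⟩
  have hv₁' := hs₁ hv₁
  have hv₂' := hs₂ hv₂
  rw [support_reverse, List.mem_reverse] at hv₂'
  obtain ⟨j, hj, hjl⟩ := mem_support_iff_exists_getVert.1 hv₁'
  obtain ⟨k, hk, hkl⟩ := mem_support_iff_exists_getVert.1 hv₂'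
  rw [drop_getVert] at hj
  rw [take_getVert] at hk
  rw [drop_length] at hjl
  rw [take_length] at hkl
  have := hp.getVert_injOn (x₁ := i + j) (x₂ := i ⊓ k) (by simp; omega) (by simp; omega)
    (hj.trans hk.symm)
  rw [← hj]
  congr 1
  omega

end SimpleGraph.Walk

section WalkLen

variable {V : Type*} {G : SimpleGraph V}

lemma walkLen_eq_sum (ω : V → ℝ) {x y : V} (w : G.Walk x y) :
    walkLen G ω w =
      ∑ i ∈ Finset.range w.length, (ω (w.getVert i) + ω (w.getVert (i + 1))) / 2 := by
  induction w with
  | nil => simp [walkLen]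
  | cons h p ih =>
    rw [SimpleGraph.Walk.length_cons, Finset.sum_range_succ']
    simp only [SimpleGraph.Walk.getVert_cons_succ, ← ih]
    simp [walkLen, add_comm]

lemma walkLen_bypass_le [DecidableEq V] {ω : V → ℝ} (hω : ∀ v, 0 ≤ ω v) {x y : V}
    (w : G.Walk x y) : walkLen G ω w.bypass ≤ walkLen G ω w := by
  have hnd : w.bypass.darts.Nodup :=
    SimpleGraph.Walk.darts_nodup_of_support_nodup w.bypass_isPath.support_nodup
  obtain ⟨l, hl, hsub⟩ := List.subperm_of_subset hnd w.darts_bypass_subset_darts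
  unfold walkLen
  rw [← (hl.map _).sum_eq]
  refine (hsub.map _).sum_le_sum fun a ha => ?_
  obtain ⟨d, -, rfl⟩ := List.mem_map.1 ha
  have := hω d.toProd.1
  have := hω d.toProd.2
  positivity

/-- If the weight is at least `c` on all vertices at positions `N, …, p.length - N`, then the
weighted length is at least `c * (p.length - 2 * N)`. -/
lemma le_walkLen {ω : V → ℝ} (hω : ∀ v, 0 ≤ ω v) {c : ℝ} (hc : 0 ≤ c) {N : ℕ} {x y : V}
    (p : G.Walk x y) (h : ∀ i, N ≤ i → i + N ≤ p.length → c ≤ ω (p.getVert i)) :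
    c * ((p.length : ℝ) - 2 * N) ≤ walkLen G ω p := by
  rw [walkLen_eq_sum]
  have hnn : ∀ i, 0 ≤ (ω (p.getVert i) + ω (p.getVert (i + 1))) / 2 := fun i => by
    have := hω (p.getVert i)
    have := hω (p.getVert (i + 1))
    positivity
  rcases le_total (2 * N) p.length with hN | hN
  · calc c * ((p.length : ℝ) - 2 * N) = ∑ i ∈ Finset.Ico N (p.length - N), c := by
          rw [Finset.sum_const, Nat.card_Ico, nsmul_eq_mul, mul_comm,
            Nat.sub_sub, ← two_mul, Nat.cast_sub hN]
          push_cast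
          ring
      _ ≤ ∑ i ∈ Finset.Ico N (p.length - N),
            (ω (p.getVert i) + ω (p.getVert (i + 1))) / 2 := by
          refine Finset.sum_le_sum fun i hi => ?_
          rw [Finset.mem_Ico] at hi
          linarith [h i hi.1 (by omega), h (i + 1) (by omega) (by omega)]
      _ ≤ _ := by
          refine Finset.sum_le_sum_of_subset_of_nonneg (fun i hi => ?_) fun i _ _ => hnn i
          rw [Finset.mem_Ico] at hi
          rw [Finset.mem_range]
          omega
  · have hN' : (p.length : ℝ) ≤ 2 * N := by exact_mod_cast hN
    exact (mul_nonpos_of_nonneg_of_nonpos hc (by linarith)).trans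
      (Finset.sum_nonneg fun i _ => hnn i)

end WalkLen

/-- For the weight `ω = c · 1_{B°}`, where `B°` is the union of backbones of
`α`-deep members of the cover `𝒞`, the conformal distance satisfies
`dist_ω(x, y) ≥ c · (dist_G(x, y) - 2N - 1)` for all `x, y` in the same
connected component of `G`. -/
theorem stmt12 {V : Type*} (𝒢 G : SimpleGraph V) (hle : G ≤ 𝒢)
    (𝒞 : Set (Set V)) (N : ℕ) (hN : 1 ≤ N) (α : ℝ) (hα : 0 ≤ α)
    (hfin : ∀ S ∈ 𝒞, S.Finite ∧ S.ncard ≤ N)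
    (hpad : ∀ v : V, ∃ S ∈ 𝒞, gball 𝒢 v α ⊆ S)
    (c : ℝ) (hc : 0 ≤ c)
    (B : Set V) (hB : B = ⋃ S ∈ { S | S ∈ 𝒞 ∧ Deep 𝒢 G α S }, Backbone G S)
    (ω : V → ℝ) (hωdef : ω = B.indicator fun _ => c)
    (x y : V) (hxy : G.Reachable x y) :
    ENNReal.ofReal (c * ((G.dist x y : ℝ) - 2 * N - 1)) ≤ wdist G ω x y := by
  classical
  have hω : ∀ v, 0 ≤ ω v := fun v => hωdef ▸ Set.indicator_nonneg (fun _ _ => hc) v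
  refine le_iInf fun w => ENNReal.ofReal_le_ofReal ?_
  refine le_trans ?_ (walkLen_bypass_le hω w)
  have hlen : (G.dist x y : ℝ) ≤ w.bypass.length := by
    exact_mod_cast SimpleGraph.dist_le w.bypass
  refine (mul_le_mul_of_nonneg_left (by linarith) hc).trans
    (le_walkLen hω hc (N := N) w.bypass fun i h1 h2 => ?_)
  obtain ⟨S, hS, hball⟩ := hpad (w.bypass.getVert i)
  obtain ⟨hSfin, hcard⟩ := hfin S hS
  have hz : w.bypass.getVert i ∈ S := hball ⟨.rfl, by simpa using hα⟩
  obtain ⟨hbb, hexit⟩ := w.bypass_isPath.getVert_mem_backbone hSfin (hcard.trans h1)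
    (by omega) hz
  have hmem : w.bypass.getVert i ∈ B :=
    hB ▸ Set.mem_biUnion (x := S) ⟨hS, _, hz, hball, hexit⟩ hbb
  rw [hωdef, Set.indicator_of_mem hmem]
end
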